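/- arXiv:1207.4335 — 2 statements merged into one kernel-verified Lean document; each statement's English description precedes it below -/
import Mathlib

section
/- Let θ₀, θ∞ ∈ ℂ, let U ⊆ ℂ be open and let q : U → ℂ be twice complex differentiable and nowhere zero. Set a₀ = q' + 1/2, b₁ = t + q, b₀ = q(t+q) + θ∞ + t²/4, b₋₁ = ((a₀ − 1/2)² − ((θ₀−1)/2)²)/q, and define for t ∈ U, z ∈ ℂ∖{0} the 2×2 matrices A(t,z) = ((a₀, z² + b₁z + b₀ + b₋₁z⁻¹), (z² − qz, −a₀)) and B(t,z) = ((0, (q(q+b₁)+b₀)/2 · z⁻¹ + (b₁+q)/2 + z/2), (z/2, 0)). Then the Lax equation ∂A/∂t (t,z) = z·∂B/∂z (t,z) + A(t,z)B(t,z) − B(t,z)A(t,z) holds for all t ∈ U and all z ∈ ℂ∖{0} if and only if q satisfies PIV(θ₀,θ∞) on U. -/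
open Matrix

/-- `a₀ = q' + 1/2`. -/
noncomputable def PIVa₀ (q : ℂ → ℂ) (t : ℂ) : ℂ := deriv q t + 1/2

/-- `b₁ = t + q`. -/
noncomputable def PIVb₁ (q : ℂ → ℂ) (t : ℂ) : ℂ := t + q t

/-- `b₀ = q(t+q) + θ∞ + t²/4`. -/
noncomputable def PIVb₀ (θinf : ℂ) (q : ℂ → ℂ) (t : ℂ) : ℂ :=
  q t * (t + q t) + θinf + t ^ 2 / 4

/-- `b₋₁ = ((a₀ − 1/2)² − ((θ₀−1)/2)²)/q`. -/
noncomputable def PIVbm1 (θ₀ : ℂ) (q : ℂ → ℂ) (t : ℂ) : ℂ :=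
  ((PIVa₀ q t - 1/2) ^ 2 - ((θ₀ - 1) / 2) ^ 2) / q t

/-- The matrix `A(t,z)` of the isomonodromic family over the chart `ST₂`. -/
noncomputable def PIVA (θ₀ θinf : ℂ) (q : ℂ → ℂ) (t z : ℂ) : Matrix (Fin 2) (Fin 2) ℂ :=
  !![PIVa₀ q t, z ^ 2 + PIVb₁ q t * z + PIVb₀ θinf q t + PIVbm1 θ₀ q t * z⁻¹;
     z ^ 2 - q t * z, -(PIVa₀ q t)]

/-- The matrix `B(t,z)` of the Lax pair over the chart `ST₂`. -/
noncomputable def PIVB (θinf : ℂ) (q : ℂ → ℂ) (t z : ℂ) : Matrix (Fin 2) (Fin 2) ℂ :=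
  !![0, (q t * (q t + PIVb₁ q t) + PIVb₀ θinf q t) / 2 * z⁻¹ + (PIVb₁ q t + q t) / 2 + z / 2;
     z / 2, 0]

theorem PIVaux {f g : ℂ → ℂ} {a b x : ℂ} (h : HasDerivAt f a x) (hf : g = f) (ha : b = a) :
    HasDerivAt g b x := by
  rw [hf, ha]
  exact h

/-- The Lax equation `∂A/∂t = z·∂B/∂z + [A,B]` holds (for all `t ∈ U`, `z ≠ 0`)
if and only if `q` satisfies the fourth Painlevé equation `PIV(θ₀,θ∞)` on `U`. -/
theorem stmt_2 (θ₀ θinf : ℂ) (U : Set ℂ) (hU : IsOpen U) (q : ℂ → ℂ)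
    (hq : ∀ t ∈ U, DifferentiableAt ℂ q t)
    (hq' : ∀ t ∈ U, DifferentiableAt ℂ (deriv q) t)
    (hq0 : ∀ t ∈ U, q t ≠ 0) :
    (∀ t ∈ U, ∀ z : ℂ, z ≠ 0 → ∀ i j : Fin 2,
        deriv (fun s => PIVA θ₀ θinf q s z i j) t =
          z * deriv (fun w => PIVB θinf q t w i j) z +
            (PIVA θ₀ θinf q t z * PIVB θinf q t z
              - PIVB θinf q t z * PIVA θ₀ θinf q t z) i j) ↔
    (∀ t ∈ U, deriv (deriv q) t =
        (deriv q t) ^ 2 / (2 * q t) + (3/2) * (q t) ^ 3 + t * (q t) ^ 2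
          + (q t / 8) * (4 * θinf + t ^ 2) - (θ₀ - 1) ^ 2 / (8 * q t)) := by
  have key : ∀ t ∈ U, ∀ z : ℂ, z ≠ 0 →
      ((PIVA θ₀ θinf q t z * PIVB θinf q t z
              - PIVB θinf q t z * PIVA θ₀ θinf q t z) 0 0 =
        (deriv q t) ^ 2 / (2 * q t) + (3/2) * (q t) ^ 3 + t * (q t) ^ 2
          + (q t / 8) * (4 * θinf + t ^ 2) - (θ₀ - 1) ^ 2 / (8 * q t)) := by
    intro t ht z hz
    have h0 := hq0 t ht
    simp [PIVA, PIVB, PIVa₀, PIVb₁, PIVb₀, PIVbm1, Matrix.mul_apply, Fin.sum_univ_two]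
    field_simp
    ring
  have key2 : ∀ t ∈ U, ∀ z : ℂ, z ≠ 0 →
      ((PIVA θ₀ θinf q t z * PIVB θinf q t z
              - PIVB θinf q t z * PIVA θ₀ θinf q t z) 1 1 =
        -((deriv q t) ^ 2 / (2 * q t) + (3/2) * (q t) ^ 3 + t * (q t) ^ 2
          + (q t / 8) * (4 * θinf + t ^ 2) - (θ₀ - 1) ^ 2 / (8 * q t))) := by
    intro t ht z hz
    rw [← key t ht z hz]
    simp [Matrix.mul_apply, Fin.sum_univ_two, PIVA, PIVB]
    ring
  have d00 : ∀ t ∈ U, ∀ z : ℂ, deriv (fun s => PIVA θ₀ θinf q s z 0 0) t = deriv (deriv q) t := by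
    intro t ht z
    simp [PIVA, PIVa₀]
  have e00 : ∀ t z : ℂ, deriv (fun w => PIVB θinf q t w 0 0) z = 0 := by
    intro t z
    simp [PIVB]
  constructor
  · intro h t ht
    have := h t ht 1 one_ne_zero 0 0
    rw [d00 t ht, e00, key t ht 1 one_ne_zero] at this
    simpa using this
  · intro h t ht z hz i j
    have h0 := hq0 t ht
    have hr := h t ht
    have hd := (hq t ht).hasDerivAt
    have hd' := (hq' t ht).hasDerivAt
    have ht' := hasDerivAt_id t
    have hz' := hasDerivAt_id z
    have hab : ∀ (i j : Fin 2), i = 0 ∨ i = 1 := by decide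
    rcases hab i i with rfl | rfl <;> rcases hab j j with rfl | rfl
    · rw [d00 t ht, e00, key t ht z hz, hr]; simp
    · have h1 : HasDerivAt (fun s => PIVA θ₀ θinf q s z 0 1)
          ((1 + deriv q t) * z + (deriv q t * (t + q t) + q t * (1 + deriv q t) + t / 2)
            + ((2 * deriv q t * deriv (deriv q) t) * q t
              - (deriv q t ^ 2 - ((θ₀ - 1) / 2) ^ 2) * deriv q t) / q t ^ 2 * z⁻¹) t := by
        have hb1 := ht'.add hd
        have hb0 := ((hd.mul hb1).add_const θinf).add ((ht'.pow 2).div_const 4)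
        have hbm := ((hd'.pow 2).sub_const (((θ₀ - 1) / 2) ^ 2)).div hd h0
        have := (((hb1.mul_const z).const_add (z ^ 2)).add hb0).add (hbm.mul_const z⁻¹)
        refine PIVaux this ?_ ?_
        · funext s
          simp [PIVA, PIVa₀, PIVb₁, PIVb₀, PIVbm1]
        · simp
          ring
      have h2 : HasDerivAt (fun w => PIVB θinf q t w 0 1)
          ((q t * (q t + PIVb₁ q t) + PIVb₀ θinf q t) / 2 * (-(z ^ 2)⁻¹) + 1 / 2) z := by
        have := (((hasDerivAt_inv hz).const_mul
          ((q t * (q t + PIVb₁ q t) + PIVb₀ θinf q t) / 2)).add_const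
            ((PIVb₁ q t + q t) / 2)).add (hz'.div_const 2)
        refine PIVaux this ?_ ?_ <;> first | rfl | (funext s; simp [PIVA, PIVB, PIVa₀]) | simp
      rw [h1.deriv, h2.deriv, hr]
      simp [PIVA, PIVB, PIVa₀, PIVb₁, PIVb₀, Matrix.mul_apply, Fin.sum_univ_two]
      field_simp
      ring
    · have h1 : HasDerivAt (fun s => PIVA θ₀ θinf q s z 1 0) (-(deriv q t * z)) t := by
        have := (hd.mul_const z).const_sub (z ^ 2)
        refine PIVaux this ?_ ?_ <;> first | rfl | (funext s; simp [PIVA, PIVB, PIVa₀]) | simp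
      have h2 : HasDerivAt (fun w => PIVB θinf q t w 1 0) (1 / 2) z := by
        have := hz'.div_const 2
        refine PIVaux this ?_ ?_ <;> first | rfl | (funext s; simp [PIVA, PIVB, PIVa₀]) | simp
      rw [h1.deriv, h2.deriv]
      simp [PIVA, PIVB, PIVa₀, Matrix.mul_apply, Fin.sum_univ_two]
      ring
    · have h1 : HasDerivAt (fun s => PIVA θ₀ θinf q s z 1 1) (-(deriv (deriv q) t)) t := by
        have := (hd'.add_const (1/2)).neg
        refine PIVaux this ?_ ?_ <;> first | rfl | (funext s; simp [PIVA, PIVB, PIVa₀]) | simp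
      have h2 : deriv (fun w => PIVB θinf q t w 1 1) z = 0 := by
        simp [PIVB]
      rw [h1.deriv, h2, key2 t ht z hz, hr]; simp
end

section
/- Let θ₀, θ∞ ∈ ℂ, let U ⊆ ℂ be open, and let q : U → ℂ be twice complex differentiable, nowhere zero, and satisfy PIV(θ₀,θ∞) on U. Set a = q' + 1/2 and assume the function qt − θ₀ + 2a + 2q² is nowhere zero on U. Define q̃ = (−4q²θ∞ + 4a² − 4q³t − q²t² − 4q⁴ − 4q²θ₀ + θ₀² − 4aθ₀) / (4q(qt − θ₀ + 2a + 2q²)). If q̃ is nowhere zero on U, then q̃ satisfies PIV(θ₀+1, θ∞+1) on U. -/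
/-- The Bäcklund transform `q̃` of `q`, where `a = q' + 1/2`:
`q̃ = (−4q²θ∞ + 4a² − 4q³t − q²t² − 4q⁴ − 4q²θ₀ + θ₀² − 4aθ₀) / (4q(qt − θ₀ + 2a + 2q²))`. -/
noncomputable def backlund (θ₀ θinf : ℂ) (q : ℂ → ℂ) (t : ℂ) : ℂ :=
  (-4 * (q t) ^ 2 * θinf + 4 * (deriv q t + 1/2) ^ 2 - 4 * (q t) ^ 3 * t
      - (q t) ^ 2 * t ^ 2 - 4 * (q t) ^ 4 - 4 * (q t) ^ 2 * θ₀ + θ₀ ^ 2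
      - 4 * (deriv q t + 1/2) * θ₀) /
    (4 * q t * (q t * t - θ₀ + 2 * (deriv q t + 1/2) + 2 * (q t) ^ 2))

/-- If `q` is a nowhere-zero solution of `PIV(θ₀,θ∞)` on `U`, the denominator
`qt − θ₀ + 2a + 2q²` is nowhere zero on `U`, and the Bäcklund transform `q̃` is
nowhere zero on `U`, then `q̃` satisfies `PIV(θ₀+1, θ∞+1)` on `U`. -/
theorem stmt_6 (θ₀ θinf : ℂ) (U : Set ℂ) (hU : IsOpen U) (q : ℂ → ℂ)
    (hq : ∀ t ∈ U, DifferentiableAt ℂ q t)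
    (hq' : ∀ t ∈ U, DifferentiableAt ℂ (deriv q) t)
    (hq0 : ∀ t ∈ U, q t ≠ 0)
    (hPIV : ∀ t ∈ U, deriv (deriv q) t =
        (deriv q t) ^ 2 / (2 * q t) + (3/2) * (q t) ^ 3 + t * (q t) ^ 2
          + (q t / 8) * (4 * θinf + t ^ 2) - (θ₀ - 1) ^ 2 / (8 * q t))
    (hden : ∀ t ∈ U, q t * t - θ₀ + 2 * (deriv q t + 1/2) + 2 * (q t) ^ 2 ≠ 0)
    (hnz : ∀ t ∈ U, backlund θ₀ θinf q t ≠ 0) :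
    ∀ t ∈ U, deriv (deriv (backlund θ₀ θinf q)) t =
      (deriv (backlund θ₀ θinf q) t) ^ 2 / (2 * backlund θ₀ θinf q t)
        + (3/2) * (backlund θ₀ θinf q t) ^ 3 + t * (backlund θ₀ θinf q t) ^ 2
        + (backlund θ₀ θinf q t / 8) * (4 * (θinf + 1) + t ^ 2)
        - ((θ₀ + 1) - 1) ^ 2 / (8 * backlund θ₀ θinf q t) := by
  -- auxiliary variable: D = 4 q f
  set D : ℂ → ℂ := fun t => q t * t - θ₀ + 2 * (deriv q t + 1/2) + 2 * (q t) ^ 2 with hD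
  set f : ℂ → ℂ := fun t => D t / (4 * q t) with hf
  set r : ℂ → ℂ := backlund θ₀ θinf q with hr
  have hf0 : ∀ t ∈ U, f t ≠ 0 := fun t ht =>
    div_ne_zero (hden t ht) (mul_ne_zero (by norm_num) (hq0 t ht))
  have hq1 : ∀ t ∈ U, deriv q t = 2 * q t * f t - q t ^ 2 - q t * t / 2 - (1 - θ₀) / 2 := by
    intro t ht
    have h := hq0 t ht
    simp only [hf, hD]
    field_simp
    ring
  have hrf : ∀ t ∈ U, r t = f t - q t - t / 2 - (θinf + θ₀) / (4 * f t) := by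
    intro t ht
    have h := hq0 t ht
    have h2 := hf0 t ht
    have e : q t * t - θ₀ + 2 * (deriv q t + 1/2) + 2 * (q t) ^ 2 = 4 * q t * f t := by
      simp only [hf, hD]
      field_simp
    simp only [hr, backlund]
    rw [e, hq1 t ht]
    field_simp
    ring
  have hfd : ∀ t ∈ U, HasDerivAt f
      (-f t ^ 2 + 2 * q t * f t + t * f t / 2 + (θinf + θ₀) / 4) t := by
    intro t ht
    have h := hq0 t ht
    have d1 := (hq t ht).hasDerivAt
    have d2 := (hq' t ht).hasDerivAt
    have dD : HasDerivAt D (deriv q t * t + q t * 1 + 2 * deriv (deriv q) t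
        + 2 * (2 * q t * deriv q t)) t := by
      have := (((d1.mul (hasDerivAt_id t)).sub_const θ₀).add
        ((d2.add_const (1/2)).const_mul 2)).add ((d1.pow 2).const_mul 2)
      refine HasDerivAt.congr_deriv this ?_
      simp
    have := dD.div (d1.const_mul 4) (mul_ne_zero (by norm_num) h)
    refine HasDerivAt.congr_deriv this ?_
    rw [hPIV t ht]
    simp only [hf, hD]
    field_simp
    ring
  have hrd : ∀ t ∈ U, HasDerivAt r
      (-2 * f t * r t + r t ^ 2 + t * r t / 2 - θ₀ / 2) t := by
    intro t ht
    have h2 := hf0 t ht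
    have d1 := (hq t ht).hasDerivAt
    have d := ((((hfd t ht).sub d1).sub ((hasDerivAt_id t).div_const 2))).sub
      ((hasDerivAt_const t (θinf + θ₀)).div ((hfd t ht).const_mul 4)
        (mul_ne_zero (by norm_num) h2))
    have d' := d.congr_of_eventuallyEq (f₁ := r) (by
      filter_upwards [hU.mem_nhds ht] with s hs
      rw [hrf s hs]
      simp)
    refine d'.congr_deriv ?_
    rw [hrf t ht, hq1 t ht]
    field_simp
    ring
  intro t ht
  have hrd2 : HasDerivAt (deriv r) _ t :=
    ((((((hfd t ht).const_mul (-2)).mul (hrd t ht)).add ((hrd t ht).pow 2)).add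
      (((hasDerivAt_id t).mul (hrd t ht)).div_const 2)).sub_const (θ₀ / 2)).congr_of_eventuallyEq
      (f₁ := deriv r) (by
        filter_upwards [hU.mem_nhds ht] with s hs
        rw [(hrd s hs).deriv]
        simp)
  have h0 : r t ≠ 0 := hnz t ht
  have h2 := hf0 t ht
  have hqr : q t = f t - r t - t / 2 - (θinf + θ₀) / (4 * f t) := by
    rw [hrf t ht]; ring
  rw [hrd2.deriv, (hrd t ht).deriv]
  rw [hqr]
  simp only [id, Nat.cast_ofNat]
  generalize r t = R at *
  generalize f t = F at *
  field_simp
  ring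
end
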